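/- arXiv:2003.09479 — 5 statements merged into one kernel-verified Lean document; each statement's English description precedes it below -/
import Mathlib

section
/- Let p_1,…,p_t be odd primes, n_1,…,n_t positive integers, and G = ∏_{i=1}^t (ℤ_{p_i} ≀ Sym_{n_i}) = V ⋊ B as described. Let H be a nontrivial subgroup of G of odd index such that for every i ∈ {1,…,t} the image of π_i(H) in B_i = Sym_{n_i} acts preprimitively on {1,…,n_i}. Then H̄ = B, i.e., the projection of H to B = ∏_{i=1}^t Sym_{n_i} is surjective. -/
/-- A subgroup `H` of a group `G` is *pronormal* in `G` if for every `g : G` the subgroups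
`H` and `H^g` are conjugate by an element of the subgroup `⟨H, H^g⟩` they generate. -/
def IsPronormal {G : Type*} [Group G] (H : Subgroup G) : Prop :=
  ∀ g : G, ∃ x ∈ H ⊔ H.map (MulAut.conj g).toMonoidHom,
    H.map (MulAut.conj x).toMonoidHom = H.map (MulAut.conj g).toMonoidHom

/-- The action of `Sym n` on `n`-tuples over `A` by permutation of coordinates. -/
def permAction (n : ℕ) (A : Type*) [AddCommGroup A] :
    Equiv.Perm (Fin n) →* MulAut (Multiplicative (Fin n → A)) where
  toFun σ := AddEquiv.toMultiplicative
    { Equiv.arrowCongr σ (Equiv.refl A) with map_add' := fun _ _ => rfl }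
  map_one' := by ext v; rfl
  map_mul' := fun σ τ => by ext v; rfl

/-- The wreath product `ℤ_p ≀ Sym_n` realized as the semidirect product `V ⋊ B`,
where `V = (Fin n → ZMod p)` and `B = Equiv.Perm (Fin n)` permutes coordinates. -/
abbrev Wreath (p n : ℕ) : Type :=
  Multiplicative (Fin n → ZMod p) ⋊[permAction n (ZMod p)] Equiv.Perm (Fin n)

/-- The additive subgroup of constant tuples. -/
def constTuples (p n : ℕ) : AddSubgroup (Fin n → ZMod p) where
  carrier := {v | ∀ i j, v i = v j}
  add_mem' := fun ha hb i j => by simp only [Pi.add_apply, ha i j, hb i j]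
  zero_mem' := fun i j => rfl
  neg_mem' := fun ha i j => by simp only [Pi.neg_apply, ha i j]

/-- The additive subgroup of tuples whose coordinates sum to `0`. -/
def sumZero (p n : ℕ) : AddSubgroup (Fin n → ZMod p) where
  carrier := {v | ∑ i, v i = 0}
  add_mem' := fun {a b} ha hb => by
    simp only [Set.mem_setOf_eq, Pi.add_apply, Finset.sum_add_distrib] at *
    rw [ha, hb, add_zero]
  zero_mem' := by simp
  neg_mem' := fun {a} ha => by
    simp only [Set.mem_setOf_eq, Pi.neg_apply, Finset.sum_neg_distrib] at *
    rw [ha, neg_zero]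

/-- `V` as a subgroup of the wreath product. -/
def Vfull (p n : ℕ) : Subgroup (Wreath p n) := SemidirectProduct.inl.range

/-- `V⁺`, the constant tuples, as a subgroup of the wreath product. -/
def Vplus (p n : ℕ) : Subgroup (Wreath p n) :=
  (AddSubgroup.toSubgroup (constTuples p n)).map SemidirectProduct.inl

/-- `V⁻`, the tuples with coordinate sum `0`, as a subgroup of the wreath product. -/
def Vminus (p n : ℕ) : Subgroup (Wreath p n) :=
  (AddSubgroup.toSubgroup (sumZero p n)).map SemidirectProduct.inl

/-- `B = Sym_n` as a subgroup of the wreath product. -/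
def Bsub (p n : ℕ) : Subgroup (Wreath p n) := SemidirectProduct.inr.range

/-- A group `G` acting on `X` acts *preprimitively* if the action is pretransitive and
every block is trivial. -/
def Preprimitive (G : Type*) (X : Type*) [Group G] [MulAction G X] : Prop :=
  MulAction.IsPretransitive G X ∧
    ∀ B : Set X, MulAction.IsBlock G B → MulAction.IsTrivialBlock B

/-- The projection of a direct product of wreath products `ℤ_{p i} ≀ Sym_{n i}` onto the
product `B = ∏ Sym_{n i}`. -/
def projB {t : ℕ} (p n : Fin t → ℕ) :
    (∀ i, Wreath (p i) (n i)) →* (∀ i, Equiv.Perm (Fin (n i))) :=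
  MonoidHom.mk' (fun g i => (g i).right) (fun _ _ => rfl)

/-- The projection onto the `i`-th factor. -/
abbrev projG {t : ℕ} (p n : Fin t → ℕ) (i : Fin t) :
    (∀ j, Wreath (p j) (n j)) →* Wreath (p i) (n i) :=
  Pi.evalMonoidHom _ i

/-- A subgroup of odd index contains a conjugate of every involution. -/
theorem Subgroup.exists_conj_mem_of_odd_index {G : Type*} [Group G] {K : Subgroup G}
    (hK : Odd K.index) {z : G} (hz : z ^ 2 = 1) : ∃ g : G, g⁻¹ * z * g ∈ K := by
  have : K.FiniteIndex := ⟨fun h => by simp [h] at hK⟩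
  have := Fintype.ofFinite (G ⧸ K)
  have hcard : ¬ 2 ∣ Fintype.card (G ⧸ K) := by
    rwa [← Nat.card_eq_fintype_card, ← Subgroup.index, ← even_iff_two_dvd, Nat.not_even_iff_odd]
  have hσ : MulAction.toPermHom G (G ⧸ K) z ^ 2 ^ 1 = 1 := by
    rw [← map_pow, pow_one, hz, map_one]
  obtain ⟨a, ha⟩ := Equiv.Perm.exists_fixed_point_of_prime hcard hσ
  induction a using QuotientGroup.induction_on with
  | H g =>
    refine ⟨g, ?_⟩
    have h : ((z * g : G) : G ⧸ K) = g := ha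
    rw [mul_assoc]
    exact QuotientGroup.eq.1 h.symm

/-- A normal subgroup of a finite symmetric group containing a transposition is everything. -/
theorem Equiv.Perm.eq_top_of_normal_of_isSwap_mem {α : Type*} [Finite α] [DecidableEq α]
    {N : Subgroup (Equiv.Perm α)} [hN : N.Normal] {τ : Equiv.Perm α} (hτ : τ.IsSwap)
    (hmem : τ ∈ N) : N = ⊤ := by
  rw [eq_top_iff, ← Equiv.Perm.closure_isSwap, Subgroup.closure_le]
  rintro σ ⟨a, b, hab, rfl⟩
  obtain ⟨c, d, hcd, rfl⟩ := hτ
  obtain ⟨g, hg⟩ := isConj_iff.1 (Equiv.Perm.isConj_swap hcd hab)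
  rw [← hg]
  exact hN.conj_mem _ hmem g

/-- A subgroup of odd index in a finite product of symmetric groups of finite sets is everything
if all its projections to the factors act primitively. -/
theorem Subgroup.eq_top_of_odd_index_of_isPreprimitive {ι : Type*} [Finite ι]
    {α : ι → Type*} [∀ i, Finite (α i)] {K : Subgroup (∀ i, Equiv.Perm (α i))}
    (hK : Odd K.index)
    (hprim : ∀ i, MulAction.IsPreprimitive (K.map (Pi.evalMonoidHom _ i)) (α i)) :
    K = ⊤ := by
  classical
  have key : ∀ i (σ : Equiv.Perm (α i)), Pi.mulSingle i σ ∈ K := by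
    intro i σ
    rcases subsingleton_or_nontrivial (α i) with hα | hα
    · rw [Subsingleton.elim σ 1, Pi.mulSingle_one]
      exact K.one_mem
    obtain ⟨a, b, hab⟩ := exists_pair_ne (α i)
    have hz : (Pi.mulSingle i (Equiv.swap a b) : ∀ i, Equiv.Perm (α i)) ^ 2 = 1 := by
      rw [← Pi.mulSingle_pow, pow_two, Equiv.swap_mul_self, Pi.mulSingle_one]
    obtain ⟨g, hg⟩ := Subgroup.exists_conj_mem_of_odd_index hK hz
    have conj_single : ∀ (h : ∀ i, Equiv.Perm (α i)) (τ : Equiv.Perm (α i)),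
        h * Pi.mulSingle i τ * h⁻¹ = Pi.mulSingle i (h i * τ * (h i)⁻¹) := by
      intro h τ
      ext1 j
      rcases eq_or_ne j i with rfl | hj
      · simp
      · simp [hj]
    set τ := (g⁻¹) i * Equiv.swap a b * ((g⁻¹) i)⁻¹ with hτ
    have hτK : Pi.mulSingle i τ ∈ K := by
      rw [← conj_single, inv_inv]
      exact hg
    have hswap : τ.IsSwap := by
      rw [hτ, ← Equiv.swap_apply_apply]
      exact ⟨_, _, fun h => hab (Equiv.injective _ h), rfl⟩
    have hproj : K.map (Pi.evalMonoidHom _ i) = ⊤ :=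
      have := hprim i
      Equiv.Perm.subgroup_eq_top_of_isPreprimitive_of_isSwap_mem this τ hswap
        ⟨_, hτK, by simp⟩
    have hN : (K.comap (MonoidHom.mulSingle (fun i => Equiv.Perm (α i)) i)).Normal := by
      refine ⟨fun ρ hρ x => ?_⟩
      obtain ⟨k, hk, rfl⟩ : x ∈ K.map (Pi.evalMonoidHom _ i) := hproj ▸ Subgroup.mem_top x
      have := K.mul_mem (K.mul_mem hk hρ) (K.inv_mem hk)
      rwa [MonoidHom.mulSingle_apply, conj_single] at this
    have htop := Equiv.Perm.eq_top_of_normal_of_isSwap_mem hswap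
      (N := K.comap (MonoidHom.mulSingle (fun i => Equiv.Perm (α i)) i)) hτK
    exact Subgroup.mem_comap.1 (htop ▸ Subgroup.mem_top σ)
  rw [eq_top_iff]
  intro x _
  exact Subgroup.pi_mem_of_mulSingle_mem x fun i => key i (x i)


/-- If `H` is a nontrivial subgroup of odd index in `∏ (ℤ_{p i} ≀ Sym_{n i})` (all `p i`
odd primes) whose projections into the symmetric groups act preprimitively, then `H`
projects onto `B = ∏ Sym_{n i}`. -/
theorem proj_eq_top (t : ℕ) (ht : 0 < t) (p n : Fin t → ℕ)
    (hp : ∀ i, (p i).Prime) (hodd : ∀ i, Odd (p i)) (hn : ∀ i, 0 < n i)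
    (H : Subgroup (∀ i, Wreath (p i) (n i))) (hne : H ≠ ⊥) (hH : Odd H.index)
    (hprim : ∀ i, Preprimitive
      ↥((H.map (projG p n i)).map SemidirectProduct.rightHom) (Fin (n i))) :
    H.map (projB p n) = ⊤ := by
  have hsurj : Function.Surjective (projB p n) := fun b =>
    ⟨fun i => SemidirectProduct.inr (b i), rfl⟩
  refine Subgroup.eq_top_of_odd_index_of_isPreprimitive
    (hH.of_dvd_nat (H.index_map_dvd hsurj)) fun i => ?_
  have hmap : (H.map (projB p n)).map (Pi.evalMonoidHom _ i) =
      (H.map (projG p n i)).map SemidirectProduct.rightHom := by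
    rw [Subgroup.map_map, Subgroup.map_map]
    rfl
  rw [hmap]
  obtain ⟨htrans, hblock⟩ := hprim i
  exact { htrans with isTrivialBlock_of_isBlock := fun {B} => hblock B }
end

section
/- Let p be an odd prime and n a positive integer with p not dividing n, and let G = ℤ_p ≀ Sym_n = V ⋊ B as described. If H is a subgroup of G with H̄ = B (H projects onto Sym_n), then H is pronormal in G. -/
/-- Conjugating `inl v` by an element of the wreath product permutes the coordinates of `v`. -/
theorem Wreath.conj_inl {p n : ℕ} (h : Wreath p n) (v : Multiplicative (Fin n → ZMod p)) :
    h * SemidirectProduct.inl v * h⁻¹ =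
      SemidirectProduct.inl (permAction n (ZMod p) h.right v) := by
  rw [mul_inv_eq_iff_eq_mul]
  ext1
  · simp [mul_comm]
  · simp

/-- Constant tuples are central in the wreath product. -/
theorem Wreath.commute_inl_of_mem_constTuples {p n : ℕ} {c : Fin n → ZMod p}
    (hc : c ∈ constTuples p n) (h : Wreath p n) :
    Commute h (SemidirectProduct.inl (Multiplicative.ofAdd c)) := by
  have hfix : permAction n (ZMod p) h.right (Multiplicative.ofAdd c) = Multiplicative.ofAdd c :=
    congrArg Multiplicative.ofAdd (funext fun i => hc (h.right.symm i) i)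
  have := Wreath.conj_inl h (Multiplicative.ofAdd c)
  rwa [hfix, mul_inv_eq_iff_eq_mul] at this

/-- If `p` does not divide `n`, an additive subgroup containing all differences `v - σ v`
contains a tuple that differs from `v` by a constant tuple. -/
theorem exists_mem_sub_mem_constTuples {p n : ℕ} [Fact p.Prime] (hn : 0 < n) (hpn : ¬ p ∣ n)
    (W : AddSubgroup (Fin n → ZMod p)) (v : Fin n → ZMod p)
    (hW : ∀ σ : Equiv.Perm (Fin n), (fun i => v i - v (σ.symm i)) ∈ W) :
    ∃ w ∈ W, v - w ∈ constTuples p n := by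
  have : NeZero n := ⟨hn.ne'⟩
  have hn0 : (n : ZMod p) ≠ 0 := by rwa [Ne, ZMod.natCast_eq_zero_iff]
  set s : Fin n → ZMod p := ∑ k : Fin n, fun i => v i - v ((Equiv.addRight k).symm i) with hs
  have hsW : s ∈ W := W.sum_mem fun k _ => hW (Equiv.addRight k)
  have hval (i : Fin n) : s i = n * v i - ∑ j, v j := by
    have hsum : ∑ k, v (i - k) = ∑ j, v j := Equiv.sum_comp (Equiv.subLeft i) v
    simp [hs, Finset.sum_apply, ← sub_eq_add_neg, hsum]
  refine ⟨(n : ZMod p)⁻¹.val • s, W.nsmul_mem hsW _, fun i j => ?_⟩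
  have hconst (i : Fin n) :
      (v - (n : ZMod p)⁻¹.val • s) i = (n : ZMod p)⁻¹ * ∑ j, v j := by
    rw [Pi.sub_apply, Pi.smul_apply, nsmul_eq_mul, ZMod.natCast_zmod_val, hval]
    field_simp
    ring
  rw [hconst, hconst]

/-- The commutator of `inl v` with an element of the wreath product lying over `σ` is the tuple
of differences `v - σ v`. -/
theorem Wreath.inl_commutator {p n : ℕ} (v : Fin n → ZMod p) (h : Wreath p n) :
    SemidirectProduct.inl (Multiplicative.ofAdd v) * h *
        (SemidirectProduct.inl (Multiplicative.ofAdd v))⁻¹ * h⁻¹ =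
      SemidirectProduct.inl (Multiplicative.ofAdd fun i => v i - v (h.right.symm i)) := by
  have hdiff : (Multiplicative.ofAdd fun i => v i - v (h.right.symm i)) =
      Multiplicative.ofAdd v * (permAction n (ZMod p) h.right (Multiplicative.ofAdd v))⁻¹ :=
    congrArg Multiplicative.ofAdd (funext fun i => sub_eq_add_neg _ _)
  rw [hdiff, map_mul, map_inv, ← Wreath.conj_inl]
  group

/-- Right multiplication by a central element does not change the conjugates of a subgroup. -/
theorem Subgroup.map_conj_mul_of_commute {G : Type*} [Group G] (H : Subgroup G) (x c : G)
    (hc : ∀ h, Commute h c) :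
    H.map (MulAut.conj (x * c)).toMonoidHom = H.map (MulAut.conj x).toMonoidHom := by
  refine congrArg (H.map ·) (MonoidHom.ext fun h => ?_)
  simp [mul_assoc, ← (hc _).eq]

/-- If `p` is an odd prime not dividing `n` and `H ≤ ℤ_p ≀ Sym_n` projects onto `Sym_n`,
then `H` is pronormal in `ℤ_p ≀ Sym_n`. -/
theorem pronormal_of_not_dvd (p n : ℕ) (hp : p.Prime) (hodd : Odd p) (hn : 0 < n)
    (hpn : ¬ p ∣ n) (H : Subgroup (Wreath p n))
    (hH : H.map SemidirectProduct.rightHom = ⊤) :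
    IsPronormal H := by
  have : Fact p.Prime := ⟨hp⟩
  have hsurj (b : Equiv.Perm (Fin n)) : ∃ h ∈ H, h.right = b := by
    have hb : b ∈ H.map SemidirectProduct.rightHom := hH ▸ Subgroup.mem_top b
    simpa using hb
  intro g
  obtain ⟨h₀, hh₀, hr⟩ := hsurj g.right
  set K := H ⊔ H.map (MulAut.conj g).toMonoidHom
  set v : Fin n → ZMod p := Multiplicative.toAdd (g * h₀⁻¹).left with hv
  have hg : g = SemidirectProduct.inl (Multiplicative.ofAdd v) * h₀ := by
    rw [← mul_inv_eq_iff_eq_mul]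
    ext1
    · simp [hv]
    · simp [hr]
  let W : AddSubgroup (Fin n → ZMod p) :=
    Subgroup.toAddSubgroup' (K.comap SemidirectProduct.inl)
  obtain ⟨w, hw, hc⟩ := exists_mem_sub_mem_constTuples hn hpn W v fun σ => by
    obtain ⟨h, hh, rfl⟩ := hsurj σ
    have hconj : SemidirectProduct.inl (Multiplicative.ofAdd v) * h *
        (SemidirectProduct.inl (Multiplicative.ofAdd v))⁻¹ ∈ K := by
      refine (le_sup_right : _ ≤ K) ⟨h₀⁻¹ * h * h₀, ?_, ?_⟩
      · exact H.mul_mem (H.mul_mem (H.inv_mem hh₀) hh) hh₀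
      · rw [hg]
        simp [mul_assoc]
    have hmem := K.mul_mem hconj (K.inv_mem ((le_sup_left : H ≤ K) hh))
    rw [Wreath.inl_commutator] at hmem
    exact hmem
  refine ⟨SemidirectProduct.inl (Multiplicative.ofAdd w) * h₀,
    K.mul_mem hw ((le_sup_left : H ≤ K) hh₀), ?_⟩
  have hvw : SemidirectProduct.inl (Multiplicative.ofAdd v) =
      (SemidirectProduct.inl (Multiplicative.ofAdd w) *
        SemidirectProduct.inl (Multiplicative.ofAdd (v - w)) : Wreath p n) := by
    rw [← map_mul, ← ofAdd_add, add_sub_cancel]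
  have hgx : g = SemidirectProduct.inl (Multiplicative.ofAdd w) * h₀ *
      SemidirectProduct.inl (Multiplicative.ofAdd (v - w)) := by
    rw [hg, hvw, mul_assoc, mul_assoc, (Wreath.commute_inl_of_mem_constTuples hc h₀).eq]
  rw [hgx, Subgroup.map_conj_mul_of_commute _ _ _ (Wreath.commute_inl_of_mem_constTuples hc)]
end

section
/- Let p be an odd prime and n a positive integer with p dividing n, and let G = ℤ_p ≀ Sym_n = V ⋊ B as described. If H is a subgroup of G with H̄ = B (H projects onto Sym_n), then H is pronormal in G if and only if V⁻ ≤ H. -/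
/-- The sum of the coordinates of the tuple part, as a homomorphism on the wreath product. -/
def coordSum (p n : ℕ) : Wreath p n →* Multiplicative (ZMod p) :=
  MonoidHom.mk' (fun g => Multiplicative.ofAdd (∑ i, g.left.toAdd i)) fun g h => by
    apply Multiplicative.toAdd.injective
    have key : ∑ i, h.left.toAdd (g.right.symm i) = ∑ i, h.left.toAdd i :=
      Equiv.sum_comp g.right.symm _
    rw [toAdd_mul, toAdd_ofAdd, toAdd_ofAdd, toAdd_ofAdd, ← key, ← Finset.sum_add_distrib]
    rfl

/-- A permutation-invariant additive group of tuples over `ZMod p` which contains a non-constant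
tuple contains every tuple with coordinate sum `0`. -/
theorem sumZero_le_of_perm_invariant {p n : ℕ} (hp : p.Prime)
    (N : AddSubgroup (Fin n → ZMod p))
    (hN : ∀ σ : Equiv.Perm (Fin n), ∀ v ∈ N, (fun k => v (σ k)) ∈ N)
    {v : Fin n → ZMod p} (hv : v ∈ N) {i j : Fin n} (hij : v i ≠ v j) :
    sumZero p n ≤ N := by
  have : Fact p.Prime := ⟨hp⟩
  have hne : i ≠ j := fun h => hij (by rw [h])
  have hc : v i - v j ≠ 0 := sub_ne_zero.mpr hij
  have hd : (Pi.single i 1 - Pi.single j 1 : Fin n → ZMod p) ∈ N := by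
    have h := ZMod.smul_mem (N.sub_mem hv (hN (Equiv.swap i j) v hv)) (v i - v j)⁻¹
    convert h using 1
    funext k
    by_cases hki : k = i
    · subst hki
      simp [hne, hc]
    · by_cases hkj : k = j
      · subst hkj
        have h1 : (v i - v k)⁻¹ * (v k - v i) = -1 := by
          rw [← neg_sub (v i) (v k), mul_neg, inv_mul_cancel₀ hc]
        simp [hki, h1]
      · simp [hki, hkj, Equiv.swap_apply_of_ne_of_ne hki hkj]
  have hk : ∀ k, (Pi.single k 1 - Pi.single i 1 : Fin n → ZMod p) ∈ N := by
    intro k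
    by_cases hki : k = i
    · simp [hki, N.zero_mem]
    · have h := N.neg_mem (hN (Equiv.swap j k) _ hd)
      convert h using 1
      funext l
      have h1 : Equiv.swap j k l = i ↔ l = i := by
        rw [Equiv.swap_apply_eq_iff, Equiv.swap_apply_of_ne_of_ne hne (Ne.symm hki)]
      have h2 : Equiv.swap j k l = j ↔ l = k := by
        rw [Equiv.swap_apply_eq_iff, Equiv.swap_apply_left]
      simp [Pi.single_apply, h1, h2]
  intro u hu
  have hu0 : ∑ k, u k = 0 := hu
  have hsum : u = ∑ k, u k • (Pi.single k 1 - Pi.single i 1 : Fin n → ZMod p) := by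
    funext l
    simp [Finset.sum_apply, mul_sub, Finset.sum_sub_distrib, hu0, Pi.single_apply]
  rw [hsum]
  exact N.sum_mem fun k _ => ZMod.smul_mem (hk k) _

section

variable {p n : ℕ}

theorem mem_Vminus_iff {g : Wreath p n} :
    g ∈ Vminus p n ↔ coordSum p n g = 1 ∧ g.right = 1 := by
  constructor
  · rintro ⟨v, hv, rfl⟩
    exact ⟨hv, rfl⟩
  · rintro ⟨hs, hr⟩
    exact ⟨g.left, hs, SemidirectProduct.ext rfl hr.symm⟩

theorem exists_mem_right_eq {H : Subgroup (Wreath p n)}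
    (hH : H.map SemidirectProduct.rightHom = ⊤) (σ : Equiv.Perm (Fin n)) :
    ∃ h ∈ H, h.right = σ := by
  have hσ : σ ∈ H.map SemidirectProduct.rightHom := hH ▸ Subgroup.mem_top σ
  exact hσ

theorem normal_of_Vminus_le {H : Subgroup (Wreath p n)}
    (hH : H.map SemidirectProduct.rightHom = ⊤) (hV : Vminus p n ≤ H) : H.Normal := by
  refine ⟨fun x hx g => ?_⟩
  obtain ⟨h, hh, hr⟩ := exists_mem_right_eq hH g.right
  have hker : g * x * g⁻¹ * (h * x * h⁻¹)⁻¹ ∈ H := by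
    refine hV (mem_Vminus_iff.mpr ⟨?_, ?_⟩)
    · simp [mul_comm]
    · simp [hr]
  rw [← inv_mul_cancel_right (g * x * g⁻¹) (h * x * h⁻¹)]
  exact H.mul_mem hker (H.mul_mem (H.mul_mem hh hx) (H.inv_mem hh))

/-- If `H` projects onto `Sym n` and contains a non-constant tuple, then `V⁻ ≤ H`. -/
theorem Vminus_le_of_not_const (hp : p.Prime) {H : Subgroup (Wreath p n)}
    (hH : H.map SemidirectProduct.rightHom = ⊤) {x : Wreath p n} (hx : x ∈ H)
    (hx1 : x.right = 1) {i j : Fin n} (hij : x.left.toAdd i ≠ x.left.toAdd j) :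
    Vminus p n ≤ H := by
  have hle : sumZero p n ≤ Subgroup.toAddSubgroup' (H.comap SemidirectProduct.inl) := by
    refine sumZero_le_of_perm_invariant hp _ (fun σ v hv => ?_) (v := x.left.toAdd) ?_ hij
    · obtain ⟨h, hh, hr⟩ := exists_mem_right_eq hH σ⁻¹
      have hmem := H.mul_mem (H.mul_mem hh hv) (H.inv_mem hh)
      change SemidirectProduct.inl (Multiplicative.ofAdd fun k => v (σ k)) ∈ H
      convert hmem using 1
      refine SemidirectProduct.ext ?_ (by simp)
      apply Multiplicative.toAdd.injective
      funext k
      simp [hr]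
      rfl
    · change SemidirectProduct.inl x.left ∈ H
      convert hx using 1
      exact SemidirectProduct.ext rfl hx1.symm
  rintro _ ⟨v, hv, rfl⟩
  exact hle hv

/-- A tuple which every permutation moves by a constant tuple is constant, provided that there
are at least three coordinates. -/
theorem eq_of_sub_perm_const {n : ℕ} {A : Type*} [AddCommGroup A] (hn : 3 ≤ n) {w : Fin n → A}
    (hw : ∀ σ : Equiv.Perm (Fin n), ∀ i j, w i - w (σ i) = w j - w (σ j)) (i j : Fin n) :
    w i = w j := by
  obtain ⟨k, hk⟩ : ∃ k, k ∉ ({i, j} : Finset (Fin n)) := by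
    by_contra! h
    have h1 := Finset.card_le_card (fun k _ => h k : Finset.univ ⊆ ({i, j} : Finset (Fin n)))
    have h2 := Finset.card_le_two (a := i) (b := j)
    rw [Finset.card_univ, Fintype.card_fin] at h1
    omega
  simp only [Finset.mem_insert, Finset.mem_singleton, not_or] at hk
  have h := hw (Equiv.swap i j) i k
  rw [Equiv.swap_apply_left, Equiv.swap_apply_of_ne_of_ne hk.1 hk.2, sub_self] at h
  exact sub_eq_zero.mp h

/-- Elements of `⟨H, H^g⟩` for `g ∈ V` agree with elements of `H` modulo `V⁻`. -/
theorem exists_mem_of_mem_sup {H : Subgroup (Wreath p n)} {g x : Wreath p n} (hg : g.right = 1)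
    (hx : x ∈ H ⊔ H.map (MulAut.conj g).toMonoidHom) :
    ∃ h ∈ H, coordSum p n h = coordSum p n x ∧ h.right = x.right := by
  let φ := (coordSum p n).prod
    (SemidirectProduct.rightHom : Wreath p n →* Equiv.Perm (Fin n))
  have hle : H ⊔ H.map (MulAut.conj g).toMonoidHom ≤ (H.map φ).comap φ := by
    refine sup_le (Subgroup.le_comap_map _ _) ?_
    rintro _ ⟨h, hh, rfl⟩
    exact ⟨h, hh, by simp [φ, hg]⟩
  obtain ⟨h, hh, he⟩ := hle hx
  exact ⟨h, hh, congrArg Prod.fst he, congrArg Prod.snd he⟩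

theorem Vminus_le_of_isPronormal (hp : p.Prime) (hn : 3 ≤ n) (hpn : p ∣ n)
    {H : Subgroup (Wreath p n)} (hH : H.map SemidirectProduct.rightHom = ⊤)
    (hpro : IsPronormal H) : Vminus p n ≤ H := by
  have : Fact p.Prime := ⟨hp⟩
  by_contra hV
  let g : Wreath p n :=
    SemidirectProduct.inl (Multiplicative.ofAdd (Pi.single ⟨0, by omega⟩ 1))
  have hgs : coordSum p n g = Multiplicative.ofAdd 1 :=
    congrArg Multiplicative.ofAdd (Fintype.sum_pi_single' _ _)
  obtain ⟨x, hx, hconj⟩ := hpro g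
  obtain ⟨h, hh, hs, hr⟩ := exists_mem_of_mem_sup (g := g) rfl hx
  let w : Wreath p n := g⁻¹ * (x * h⁻¹)
  have hwr : w.right = 1 := by simp [w, g, hr]
  have hws : coordSum p n w = Multiplicative.ofAdd (-1) := by
    simp [w, hs, hgs]
  have hnorm : ∀ y ∈ H, w * y * w⁻¹ ∈ H := by
    intro y hy
    have hy' : x * (h⁻¹ * y * h) * x⁻¹ ∈ H.map (MulAut.conj g).toMonoidHom := by
      rw [← hconj]
      exact ⟨_, H.mul_mem (H.mul_mem (H.inv_mem hh) hy) hh, rfl⟩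
    obtain ⟨z, hz, hze⟩ := hy'
    have hze' : g * z * g⁻¹ = x * (h⁻¹ * y * h) * x⁻¹ := hze
    have : w * y * w⁻¹ = z := by
      calc w * y * w⁻¹ = g⁻¹ * (x * (h⁻¹ * y * h) * x⁻¹) * g := by simp only [w]; group
        _ = z := by rw [← hze']; group
    rwa [this]
  have hconst : ∀ i j, w.left.toAdd i = w.left.toAdd j := by
    refine eq_of_sub_perm_const hn fun σ i j => ?_
    obtain ⟨y, hy, hyr⟩ := exists_mem_right_eq hH σ⁻¹
    have hmem := H.mul_mem (hnorm y hy) (H.inv_mem hy)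
    have hleft : ∀ k, (w * y * w⁻¹ * y⁻¹).left.toAdd k
        = w.left.toAdd k - w.left.toAdd (σ k) := by
      intro k
      simp [hyr, hwr]
      abel_nf
      rfl
    by_contra hne
    refine hV (Vminus_le_of_not_const hp hH hmem ?_ (i := i) (j := j) ?_)
    · simp [hwr]
    · rwa [hleft, hleft]
  have hzero : ∑ i, w.left.toAdd i = 0 := by
    rw [Finset.sum_congr rfl fun i _ => hconst i ⟨0, by omega⟩]
    simp [(ZMod.natCast_eq_zero_iff n p).mpr hpn]
  have hneg : ∑ i, w.left.toAdd i = -1 := congrArg Multiplicative.toAdd hws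
  exact neg_ne_zero.mpr one_ne_zero (hneg.symm.trans hzero)

end

/-- If `p` is an odd prime dividing `n` and `H ≤ ℤ_p ≀ Sym_n` projects onto `Sym_n`,
then `H` is pronormal in `ℤ_p ≀ Sym_n` if and only if `V⁻ ≤ H`. -/
theorem pronormal_iff_Vminus_le (p n : ℕ) (hp : p.Prime) (hodd : Odd p) (hn : 0 < n)
    (hpn : p ∣ n) (H : Subgroup (Wreath p n))
    (hH : H.map SemidirectProduct.rightHom = ⊤) :
    IsPronormal H ↔ Vminus p n ≤ H := by
  have hp3 : 3 ≤ p := by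
    obtain ⟨k, hk⟩ := hodd
    have := hp.two_le
    omega
  refine ⟨Vminus_le_of_isPronormal hp (hp3.trans (Nat.le_of_dvd hn hpn)) hpn hH, fun hV g => ?_⟩
  have := normal_of_Vminus_le hH hV
  exact ⟨1, one_mem _, (Subgroup.Normal.map_conj_eq H 1).trans
    (Subgroup.Normal.map_conj_eq H g).symm⟩
end

section
/- Let p be an odd prime and n a positive integer, and let G = ℤ_p ≀ Sym_n = V ⋊ B as described. If U is a subgroup of V that is invariant under the permutation action of B = Sym_n on V (equivalently, invariant under conjugation in G by every element of B), then U is one of the four subgroups 0, V⁺, V⁻, V. -/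
/-- Swapping two coordinates changes a tuple by a multiple of a difference of basis vectors. -/
theorem sub_comp_swap {ι A : Type*} [DecidableEq ι] [AddCommGroup A] (v : ι → A) {i j : ι}
    (hij : i ≠ j) :
    v - v ∘ Equiv.swap i j = Pi.single i (v i - v j) - Pi.single j (v i - v j) := by
  funext k
  by_cases hi : k = i
  · subst hi; simp [hij]
  by_cases hj : k = j
  · subst hj; simp [hij]
  simp [hi, hj, Equiv.swap_apply_of_ne_of_ne hi hj]

/-- A permutation-invariant subgroup containing a nonconstant tuple contains every tuple
with coordinate sum `0`. -/
theorem sumZero_le_of_apply_ne (p n : ℕ) [Fact p.Prime] (U : AddSubgroup (Fin n → ZMod p))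
    (hU : ∀ σ : Equiv.Perm (Fin n), ∀ v ∈ U, v ∘ ⇑σ⁻¹ ∈ U)
    {v : Fin n → ZMod p} (hv : v ∈ U) {i j : Fin n} (hij : v i ≠ v j) : sumZero p n ≤ U := by
  have hne : i ≠ j := fun h => hij (congrArg v h)
  have hd : v i - v j ≠ 0 := sub_ne_zero.mpr hij
  have hbase : Pi.single i (1 : ZMod p) - Pi.single j 1 ∈ U := by
    have h := ZMod.smul_mem (U.sub_mem hv (hU (Equiv.swap i j) v hv)) (v i - v j)⁻¹
    rwa [Equiv.swap_inv, sub_comp_swap v hne, smul_sub, ← Pi.single_smul, ← Pi.single_smul,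
      smul_eq_mul, inv_mul_cancel₀ hd] at h
  have hall (k : Fin n) : Pi.single k (1 : ZMod p) - Pi.single j 1 ∈ U := by
    by_cases hk : k = j
    · subst hk; simp
    have h := hU (Equiv.swap i k) _ hbase
    convert h using 1
    funext l
    have hl : l = k ↔ Equiv.swap i k l = i := by
      rw [Equiv.swap_apply_eq_iff, Equiv.swap_apply_left]
    have hlj : l = j ↔ Equiv.swap i k l = j := by
      rw [Equiv.swap_apply_eq_iff, Equiv.swap_apply_of_ne_of_ne (Ne.symm hne) (Ne.symm hk)]
    simp only [Pi.sub_apply, Function.comp_apply, Equiv.swap_inv, Pi.single_apply, ← hl, ← hlj]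
  intro w hw
  have hw : ∑ k, w k = 0 := hw
  have hsum : w = ∑ k, w k • (Pi.single k (1 : ZMod p) - Pi.single j 1) := by
    simp only [smul_sub, Finset.sum_sub_distrib, ← Finset.sum_smul, hw, zero_smul, sub_zero]
    exact pi_eq_sum_univ' w
  rw [hsum]
  exact U.sum_mem fun k _ => ZMod.smul_mem (hall k) (w k)

/-- No subgroup lies strictly between the tuples with coordinate sum `0` and all tuples. -/
theorem eq_sumZero_or_eq_top_of_sumZero_le (p n : ℕ) [Fact p.Prime]
    (U : AddSubgroup (Fin n → ZMod p)) (h : sumZero p n ≤ U) : U = sumZero p n ∨ U = ⊤ := by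
  by_cases hle : U ≤ sumZero p n
  · exact Or.inl (le_antisymm hle h)
  right
  obtain ⟨u, hu, hus⟩ := SetLike.not_le_iff_exists.mp hle
  have hus : ∑ k, u k ≠ 0 := hus
  refine (AddSubgroup.eq_top_iff' U).mpr fun w => ?_
  set c : ZMod p := (∑ k, w k) / ∑ k, u k with hc
  have hdiff : w - c • u ∈ sumZero p n := by
    change ∑ k, (w - c • u) k = 0
    simp only [Pi.sub_apply, Pi.smul_apply, Finset.sum_sub_distrib, ← Finset.smul_sum]
    rw [smul_eq_mul, hc, div_mul_cancel₀ _ hus, sub_self]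
  simpa using U.add_mem (h hdiff) (ZMod.smul_mem hu c)

/-- A nonzero subgroup of the constant tuples consists of all constant tuples. -/
theorem eq_bot_or_eq_constTuples_of_le (p n : ℕ) [Fact p.Prime]
    (U : AddSubgroup (Fin n → ZMod p)) (h : U ≤ constTuples p n) :
    U = ⊥ ∨ U = constTuples p n := by
  refine or_iff_not_imp_left.mpr fun hbot => le_antisymm h fun w hw => ?_
  obtain ⟨u, hu, hu0⟩ := U.bot_or_exists_ne_zero.resolve_left hbot
  obtain ⟨i, hi⟩ := Function.ne_iff.mp hu0
  have hw_eq : w = (w i / u i) • u := by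
    funext j
    rw [Pi.smul_apply, h hu j i, smul_eq_mul, div_mul_cancel₀ _ hi]
    exact hw j i
  rw [hw_eq]
  exact ZMod.smul_mem hu _

/-- For an odd prime `p`, the only subgroups of `V = (Fin n → ZMod p)` invariant under the
coordinate-permutation action of `Sym_n` are `0`, `V⁺`, `V⁻` and `V`. -/
theorem invariant_subgroups (p n : ℕ) (hp : p.Prime) (hodd : Odd p) (hn : 0 < n)
    (U : AddSubgroup (Fin n → ZMod p))
    (hU : ∀ σ : Equiv.Perm (Fin n), ∀ v ∈ U, v ∘ ⇑σ⁻¹ ∈ U) :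
    U = ⊥ ∨ U = constTuples p n ∨ U = sumZero p n ∨ U = ⊤ := by
  have := Fact.mk hp
  by_cases h : U ≤ constTuples p n
  · exact (eq_bot_or_eq_constTuples_of_le p n U h).imp_right Or.inl
  obtain ⟨v, hv, hvc⟩ := SetLike.not_le_iff_exists.mp h
  obtain ⟨i, j, hij⟩ : ∃ i j, v i ≠ v j := by
    by_contra! hcon
    exact hvc hcon
  exact Or.inr (Or.inr (eq_sumZero_or_eq_top_of_sumZero_le p n U
    (sumZero_le_of_apply_ne p n U hU hv hij)))
end

section
/- Let p be an odd prime and n a positive integer, let G = ℤ_p ≀ Sym_n = V ⋊ B as described, and let H be a subgroup of G with H̄ = B (H projects onto Sym_n). Then the commutator subgroups satisfy ⁅H, V⁻⁆ = ⁅H, V⁆ = V⁻, where V and V⁻ are identified with subgroups of G and commutators are taken in G. -/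
theorem permAction_apply {n : ℕ} {A : Type*} [AddCommGroup A] (σ : Equiv.Perm (Fin n))
    (v : Fin n → A) :
    permAction n A σ (Multiplicative.ofAdd v) = Multiplicative.ofAdd (v ∘ σ.symm) := rfl

open scoped commutatorElement in
theorem commutator_inl {p n : ℕ} (h : Wreath p n) (v : Fin n → ZMod p) :
    ⁅h, (SemidirectProduct.inl (Multiplicative.ofAdd v) : Wreath p n)⁆ =
      SemidirectProduct.inl (Multiplicative.ofAdd (v ∘ h.right.symm - v)) := by
  rw [commutatorElement_def, ofAdd_sub, div_eq_mul_inv, ← permAction_apply]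
  ext1
  · simp [mul_comm]
  · simp

theorem Vminus_le_Vfull (p n : ℕ) : Vminus p n ≤ Vfull p n := by
  rintro _ ⟨v, -, rfl⟩
  exact ⟨v, rfl⟩

theorem commutator_Vfull_le_Vminus {p n : ℕ} (H : Subgroup (Wreath p n)) :
    ⁅H, Vfull p n⁆ ≤ Vminus p n := by
  rw [Subgroup.commutator_le]
  rintro h - _ ⟨v, rfl⟩
  refine ⟨Multiplicative.ofAdd (v.toAdd ∘ h.right.symm - v.toAdd), ?_,
    (commutator_inl h v.toAdd).symm⟩
  change ∑ i, (v.toAdd (h.right.symm i) - v.toAdd i) = 0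
  rw [Finset.sum_sub_distrib, Equiv.sum_comp h.right.symm v.toAdd, sub_self]

theorem single_sub_single_mem_sumZero {p n : ℕ} (i j : Fin n) (a : ZMod p) :
    Pi.single i a - Pi.single j a ∈ sumZero p n := by
  change ∑ k, ((Pi.single i a : Fin n → ZMod p) k - (Pi.single j a : Fin n → ZMod p) k) = 0
  simp [Finset.sum_sub_distrib]

theorem inl_single_sub_single_mem_commutator {p n : ℕ} (hp : p.Prime) (hodd : Odd p)
    {H : Subgroup (Wreath p n)} (hH : H.map SemidirectProduct.rightHom = ⊤)
    (i j : Fin n) (a : ZMod p) :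
    (SemidirectProduct.inl (Multiplicative.ofAdd (Pi.single i a - Pi.single j a)) : Wreath p n) ∈
      ⁅H, Vminus p n⁆ := by
  have : Fact p.Prime := ⟨hp⟩
  have h2 : (2 : ZMod p) ≠ 0 :=
    Ring.two_ne_zero (by rw [ZMod.ringChar_zmod_n]; rintro rfl; exact absurd hodd (by decide))
  obtain ⟨h, hhH, hh⟩ : Equiv.swap i j ∈ H.map SemidirectProduct.rightHom := hH ▸ Subgroup.mem_top _
  have hr : h.right = Equiv.swap i j := hh
  have hw : (SemidirectProduct.inl
      (Multiplicative.ofAdd (Pi.single j (a / 2) - Pi.single i (a / 2))) : Wreath p n) ∈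
      Vminus p n := ⟨_, single_sub_single_mem_sumZero j i (a / 2), rfl⟩
  have key := Subgroup.commutator_mem_commutator hhH hw
  rw [commutator_inl, hr, Equiv.symm_swap] at key
  convert key using 3
  have hs (x y : Fin n) (b : ZMod p) :
      (Pi.single x b : Fin n → ZMod p) ∘ Equiv.swap i j = Pi.single (Equiv.swap i j x) b := by
    simpa using (Pi.single_comp_equiv (Equiv.swap i j) x b)
  ext k
  have hi := congrFun (hs i j (a / 2)) k
  have hj := congrFun (hs j i (a / 2)) k
  simp only [Equiv.swap_apply_left, Equiv.swap_apply_right, Function.comp_apply] at hi hj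
  simp only [Pi.sub_apply, Function.comp_apply, hi, hj]
  have hd (x : Fin n) : (Pi.single x a : Fin n → ZMod p) k =
      (Pi.single x (a / 2) : Fin n → ZMod p) k + (Pi.single x (a / 2) : Fin n → ZMod p) k := by
    rw [← Pi.add_apply, ← Pi.single_add, ← two_mul, mul_div_cancel₀ _ h2]
  rw [hd i, hd j]
  ring

theorem Vminus_le_commutator {p n : ℕ} (hp : p.Prime) (hodd : Odd p) (hn : 0 < n)
    {H : Subgroup (Wreath p n)} (hH : H.map SemidirectProduct.rightHom = ⊤) :
    Vminus p n ≤ ⁅H, Vminus p n⁆ := by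
  rintro _ ⟨v, hv, rfl⟩
  have hv0 : ∑ i, v.toAdd i = 0 := hv
  have hdecomp : v.toAdd =
      ∑ i, (Pi.single i (v.toAdd i) - Pi.single (⟨0, hn⟩ : Fin n) (v.toAdd i)) := by
    have hz : ∑ i, (Pi.single (⟨0, hn⟩ : Fin n) (v.toAdd i) : Fin n → ZMod p) = 0 := by
      rw [← Pi.single_zero (⟨0, hn⟩ : Fin n), ← hv0]
      exact (map_sum (AddMonoidHom.single (fun _ : Fin n => ZMod p) ⟨0, hn⟩) _ _).symm
    rw [Finset.sum_sub_distrib, Finset.univ_sum_single, hz, sub_zero]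
  rw [← ofAdd_toAdd v, hdecomp, ofAdd_sum]
  change _ ∈ ⁅H, Vminus p n⁆.comap SemidirectProduct.inl
  exact Subgroup.prod_mem _ fun i _ => inl_single_sub_single_mem_commutator hp hodd hH _ _ _

/-- If `p` is an odd prime and `H ≤ ℤ_p ≀ Sym_n` projects onto `Sym_n`, then
`⁅H, V⁻⁆ = ⁅H, V⁆ = V⁻`. -/
theorem commutator_eq_Vminus (p n : ℕ) (hp : p.Prime) (hodd : Odd p) (hn : 0 < n)
    (H : Subgroup (Wreath p n)) (hH : H.map SemidirectProduct.rightHom = ⊤) :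
    ⁅H, Vminus p n⁆ = Vminus p n ∧ ⁅H, Vfull p n⁆ = Vminus p n := by
  have hle := Vminus_le_commutator hp hodd hn hH
  have hmono : ⁅H, Vminus p n⁆ ≤ ⁅H, Vfull p n⁆ :=
    Subgroup.commutator_mono le_rfl (Vminus_le_Vfull p n)
  have hge := commutator_Vfull_le_Vminus H
  exact ⟨le_antisymm (hmono.trans hge) hle, le_antisymm hge (hle.trans hmono)⟩
end
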